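/- Let A ≥ 1 be a natural number and let I_1, …, I_A be intervals (order-connected subsets) of ℝ. Suppose there is a point r* ∈ ℝ with r* ∈ I_a for every a ∈ {1, …, A}, and let τ ∈ (0, 1). Then the majority-vote set M = { x ∈ ℝ : (1/A) · #{ a ∈ {1,…,A} : x ∈ I_a } > τ } is again an interval (order-connected), and r* ∈ M. -/

import Mathlib

/-- Majority-vote combination of intervals all containing a common point `r`
is again an interval (order-connected set), and contains `r`. -/
theorem majority_vote_ordConnected
    (A : ℕ) (hA : 1 ≤ A) (I : Fin A → Set ℝ)
    (hI : ∀ a, (I a).OrdConnected) (r : ℝ) (hr : ∀ a, r ∈ I a)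
    (τ : ℝ) (hτ : τ ∈ Set.Ioo (0 : ℝ) 1) :
    ({x : ℝ | (1 / (A : ℝ)) * (Nat.card {a : Fin A // x ∈ I a} : ℝ) > τ}).OrdConnected ∧
      r ∈ {x : ℝ | (1 / (A : ℝ)) * (Nat.card {a : Fin A // x ∈ I a} : ℝ) > τ} := by
  have key : ∀ x z : ℝ, (∀ a, x ∈ I a → z ∈ I a) →
      (1 / (A : ℝ)) * (Nat.card {a : Fin A // x ∈ I a} : ℝ) ≤
      (1 / (A : ℝ)) * (Nat.card {a : Fin A // z ∈ I a} : ℝ) := by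
    intro x z h
    have h1 : Nat.card {a : Fin A // x ∈ I a} ≤ Nat.card {a : Fin A // z ∈ I a} :=
      Nat.card_le_card_of_injective (Subtype.map id h)
        (Subtype.map_injective h Function.injective_id)
    have h2 : (Nat.card {a : Fin A // x ∈ I a} : ℝ) ≤ Nat.card {a : Fin A // z ∈ I a} := by
      exact_mod_cast h1
    exact mul_le_mul_of_nonneg_left h2 (by positivity)
  refine ⟨⟨?_⟩, ?_⟩
  · intro x hx y hy z hz
    rcases le_total z r with h | h
    · exact lt_of_lt_of_le hx (key x z fun a ha => (hI a).out ha (hr a) ⟨hz.1, h⟩)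
    · exact lt_of_lt_of_le hy (key y z fun a ha => (hI a).out (hr a) ha ⟨h, hz.2⟩)
  · have hA' : (A : ℝ) ≠ 0 := by
      have : A ≠ 0 := by omega
      exact_mod_cast this
    have hc : Nat.card {a : Fin A // r ∈ I a} = A := by
      rw [Nat.card_congr (Equiv.subtypeUnivEquiv hr)]
      simp
    rw [Set.mem_setOf_eq, hc, one_div, inv_mul_cancel₀ hA']
    exact hτ.2
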